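/- Let H ⊆ ℝ^n be a finite set with inference dimension d, and let s be an integer with 2d ≤ s ≤ |H|. For a subset S ⊆ H of size s, let E(S) denote the event that there exists x ∈ ℝ^n with |infer(S,x) ∩ H| < |H|/8; for a pair (S,T) with T ⊆ S, |T| = 2d, let E(S,T) denote the event that there exists x ∈ ℝ^n with |infer(T,x) ∩ H| < |H|/8 and |infer(T,x) ∩ S| ≥ |S|/4. Then, for S a uniformly random subset of H of size s and T a uniformly random subset of S of size 2d, Pr[E(S)] ≤ 4·Pr[E(S,T)]. Equivalently, (#{S : E(S) holds}) / binomial(|H|,s) ≤ 4·(#{(S,T) : T ⊆ S, |S|=s, |T|=2d, E(S,T) holds}) / (binomial(|H|,s)·binomial(s,2d)). -/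

import Mathlib

open Finset

namespace LDT

/-- The standard inner product on `ℝ^n`. -/
def ip {n : ℕ} (x h : Fin n → ℝ) : ℝ := ∑ i, x i * h i

/-- `S` infers `h` at `x`: the sign of `⟨x,h⟩` is determined by the signs of `⟨x,v⟩` for
`v ∈ S ∪ (S - S)`, i.e. every `x'` with the same sign pattern as `x` on `S ∪ (S-S)` gives the
same sign on `h`. -/
def Infers {n : ℕ} (S : Finset (Fin n → ℝ)) (x h : Fin n → ℝ) : Prop :=
  ∀ x' : Fin n → ℝ,
    (∀ v ∈ S, SignType.sign (ip x' v) = SignType.sign (ip x v)) →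
    (∀ v ∈ S, ∀ w ∈ S, SignType.sign (ip x' (v - w)) = SignType.sign (ip x (v - w))) →
    SignType.sign (ip x' h) = SignType.sign (ip x h)

/-- `H` has inference dimension at most `d`: every subset `S ⊆ H` of size at least `d` contains,
for every `x`, an element `h` inferred by `S \ {h}` at `x`. -/
def InfProp {n : ℕ} (H : Finset (Fin n → ℝ)) (d : ℕ) : Prop :=
  ∀ S ⊆ H, d ≤ S.card → ∀ x : Fin n → ℝ, ∃ h ∈ S, Infers (S.erase h) x h

open scoped Classical

lemma Infers.mono {n : ℕ} {S T : Finset (Fin n → ℝ)} {x h : Fin n → ℝ} (hTS : T ⊆ S)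
    (hT : Infers T x h) : Infers S x h :=
  fun x' h₁ h₂ => hT x' (fun v hv => h₁ v (hTS hv))
    (fun v hv w hw => h₂ v (hTS hv) w (hTS hw))

lemma infers_of_mem {n : ℕ} {S : Finset (Fin n → ℝ)} {h : Fin n → ℝ} (hS : h ∈ S)
    (x : Fin n → ℝ) : Infers S x h :=
  fun _ h₁ _ => h₁ h hS

/-- In any subset of `H`, fewer than `d` elements fail to be inferred by the others. -/
lemma InfProp.card_not_infers_erase_lt {n d : ℕ} {H U : Finset (Fin n → ℝ)}
    (hdim : InfProp H d) (hU : U ⊆ H) (x : Fin n → ℝ) :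
    (U.filter (fun h => ¬ Infers (U.erase h) x h)).card < d := by
  by_contra! hcard
  obtain ⟨h, hh, hinf⟩ := hdim _ ((filter_subset _ _).trans hU) hcard x
  exact (mem_filter.1 hh).2 (hinf.mono (erase_subset_erase _ (filter_subset _ _)))

/-- A pair `(T, h)` with `h` not inferred by `T` is determined by `insert h T` and `h`. -/
lemma sum_card_not_infers_le {n : ℕ} (S : Finset (Fin n → ℝ)) (k : ℕ) (x : Fin n → ℝ) :
    ∑ T ∈ S.powersetCard k, (S.filter (fun h => ¬ Infers T x h)).card
      ≤ ∑ U ∈ S.powersetCard (k + 1),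
          (U.filter (fun h => ¬ Infers (U.erase h) x h)).card := by
  rw [← card_sigma, ← card_sigma]
  have notMem : ∀ {T : Finset (Fin n → ℝ)} {h}, ¬ Infers T x h → h ∉ T :=
    fun hinf hT => hinf (infers_of_mem hT x)
  refine card_le_card_of_injOn (fun p => ⟨insert p.2 p.1, p.2⟩) ?_ ?_
  · rintro ⟨T, h⟩ hp
    simp only [coe_sigma, Set.mem_sigma_iff, mem_coe, mem_powersetCard, mem_filter] at hp ⊢
    obtain ⟨⟨hTS, hTk⟩, hS, hinf⟩ := hp
    refine ⟨⟨insert_subset hS hTS, ?_⟩, mem_insert_self _ _, ?_⟩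
    · rw [card_insert_of_notMem (notMem hinf), hTk]
    · rwa [erase_insert (notMem hinf)]
  · rintro ⟨T, h⟩ hp ⟨T', h'⟩ hp' heq
    simp only [coe_sigma, Set.mem_sigma_iff, mem_coe, mem_filter] at hp hp'
    simp only [Sigma.mk.injEq, heq_eq_eq] at heq ⊢
    obtain ⟨hins, rfl⟩ := heq
    refine ⟨?_, rfl⟩
    rw [← erase_insert (notMem hp.2.2), hins, erase_insert (notMem hp'.2.2)]

/-- On average, a subset of `S` of size `2 * d` infers at least half of `S`. -/
lemma InfProp.two_mul_sum_card_not_infers_le {n d : ℕ} {H S : Finset (Fin n → ℝ)}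
    (hdim : InfProp H d) (hS : S ⊆ H) (x : Fin n → ℝ) :
    2 * ∑ T ∈ S.powersetCard (2 * d), (S.filter (fun h => ¬ Infers T x h)).card
      ≤ S.card * S.card.choose (2 * d) := by
  have hsum : ∑ U ∈ S.powersetCard (2 * d + 1),
      (U.filter (fun h => ¬ Infers (U.erase h) x h)).card
        ≤ S.card.choose (2 * d + 1) * d := by
    rw [← card_powersetCard, ← smul_eq_mul]
    exact sum_le_card_nsmul _ _ _ fun U hU =>
      (hdim.card_not_infers_erase_lt ((mem_powersetCard.1 hU).1.trans hS) x).le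
  have hchoose := Nat.choose_succ_right_eq S.card (2 * d)
  have hle : S.card.choose (2 * d) * (S.card - 2 * d) ≤ S.card.choose (2 * d) * S.card :=
    Nat.mul_le_mul_left _ (Nat.sub_le _ _)
  have := sum_card_not_infers_le S (2 * d) x
  nlinarith

/-- At least a quarter of the subsets of `S` of size `2 * d` infer a quarter of `S`. -/
lemma InfProp.choose_le_four_mul_card {n d : ℕ} {H S : Finset (Fin n → ℝ)}
    (hdim : InfProp H d) (hS : S ⊆ H) (hpos : 0 < S.card) (x : Fin n → ℝ) :
    S.card.choose (2 * d) ≤ 4 * ((S.powersetCard (2 * d)).filter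
      (fun T => S.card ≤ 4 * (S.filter (fun h => Infers T x h)).card)).card := by
  set P := S.powersetCard (2 * d)
  set p : Finset (Fin n → ℝ) → Prop :=
    fun T => S.card ≤ 4 * (S.filter (fun h => Infers T x h)).card
  have hsplit : (P.filter p).card + (P.filter (fun T => ¬ p T)).card
      = S.card.choose (2 * d) := by
    rw [card_filter_add_card_filter_not, card_powersetCard]
  have hbad : (P.filter (fun T => ¬ p T)).card * (3 * S.card)
      ≤ 4 * ∑ T ∈ P, (S.filter (fun h => ¬ Infers T x h)).card := by
    rw [← smul_eq_mul, mul_sum]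
    refine (card_nsmul_le_sum _ _ _ fun T hT => ?_).trans
      (sum_le_sum_of_subset (filter_subset (fun T => ¬ p T) P))
    have hT := (mem_filter.1 hT).2
    have := card_filter_add_card_filter_not (s := S) (fun h => Infers T x h)
    simp only [p] at hT
    omega
  have hhalf := hdim.two_mul_sum_card_not_infers_le hS x
  have : 3 * (P.filter (fun T => ¬ p T)).card ≤ 2 * S.card.choose (2 * d) := by
    refine Nat.le_of_mul_le_mul_left ?_ hpos
    linarith
  change _ ≤ 4 * (P.filter p).card
  omega

/-- Claim 5.3, double sampling: let `H` have inference dimension `d` and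
`2d ≤ s ≤ |H|`. For `S ⊆ H` of size `s`, `E(S)` is the event that some `x` has
`|infer(S,x) ∩ H| < |H|/8`; for `T ⊆ S` of size `2d`, `E(S,T)` is the event that some `x` has
`|infer(T,x) ∩ H| < |H|/8` and `|infer(T,x) ∩ S| ≥ |S|/4`. Then, for uniformly random `S` and
`T ⊆ S`, `Pr[E(S)] ≤ 4·Pr[E(S,T)]`, written via counting. -/
theorem double_sampling {n : ℕ} (H : Finset (Fin n → ℝ)) (d s : ℕ) (hd : 1 ≤ d)
    (hdim : InfProp H d) (h2d : 2 * d ≤ s) (hs : s ≤ H.card) :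
    (((H.powersetCard s).filter
        (fun S => ∃ x : Fin n → ℝ,
          ((H.filter (fun h => Infers S x h)).card : ℝ) < (H.card : ℝ) / 8)).card : ℝ)
        / (H.card.choose s)
      ≤ 4 * ((∑ S ∈ H.powersetCard s,
            ((S.powersetCard (2 * d)).filter
              (fun T => ∃ x : Fin n → ℝ,
                ((H.filter (fun h => Infers T x h)).card : ℝ) < (H.card : ℝ) / 8 ∧
                (S.card : ℝ) / 4 ≤ ((S.filter (fun h => Infers T x h)).card : ℝ))).card : ℝ))
        / ((H.card.choose s) * (s.choose (2 * d))) := by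
  have key : ((H.powersetCard s).filter
        (fun S => ∃ x : Fin n → ℝ,
          ((H.filter (fun h => Infers S x h)).card : ℝ) < (H.card : ℝ) / 8)).card
        * s.choose (2 * d)
      ≤ 4 * ∑ S ∈ H.powersetCard s,
            ((S.powersetCard (2 * d)).filter
              (fun T => ∃ x : Fin n → ℝ,
                ((H.filter (fun h => Infers T x h)).card : ℝ) < (H.card : ℝ) / 8 ∧
                (S.card : ℝ) / 4 ≤ ((S.filter (fun h => Infers T x h)).card : ℝ))).card := by
    rw [← smul_eq_mul, mul_sum]
    refine (card_nsmul_le_sum _ _ _ fun S hS => ?_).trans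
      (sum_le_sum_of_subset (filter_subset _ _))
    obtain ⟨hS, x, hx⟩ := mem_filter.1 hS
    obtain ⟨hSH, rfl⟩ := mem_powersetCard.1 hS
    refine (hdim.choose_le_four_mul_card hSH (by omega) x).trans
      (Nat.mul_le_mul_left _ (card_le_card fun T hT => ?_))
    obtain ⟨hTS, hT⟩ := mem_filter.1 hT
    refine mem_filter.2 ⟨hTS, x, lt_of_le_of_lt ?_ hx, ?_⟩
    · exact_mod_cast card_le_card
        (monotone_filter_right _ fun _ _ => Infers.mono (mem_powersetCard.1 hTS).1)
    · have : (S.card : ℝ) ≤ 4 * ((S.filter (fun h => Infers T x h)).card : ℝ) := by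
        exact_mod_cast hT
      linarith
  have hc : (0 : ℝ) < H.card.choose s := by exact_mod_cast Nat.choose_pos hs
  have hc' : (0 : ℝ) < s.choose (2 * d) := by exact_mod_cast Nat.choose_pos h2d
  rw [div_le_div_iff₀ hc (mul_pos hc hc'), mul_left_comm, mul_comm _ (H.card.choose s : ℝ)]
  refine mul_le_mul_of_nonneg_left ?_ hc.le
  exact_mod_cast key

end LDT
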